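/- arXiv:2406.11351 — 2 statements merged into one kernel-verified Lean document; each statement's English description precedes it below -/
import Mathlib

section
/- (Finite-run correspondence lemma) Let σ be a system of equations in normal form and 𝒜 the k-BRA constructed from σ as in the μ↓dω-to-BRA theorem. Then for every infinite data word w, positions i ≤ j, assignments θ, θ′, variable V ∈ Var and ω-variable x ∈ Var_ω: w,i,θ,j,θ′,x ⊨_{lfp(F_{σ,w})} V if and only if (σ(V),θ,w[i..]) ⊢*_𝒜 (σ(x),θ′,w[j..]) and σ(x) ∈ F. -/
namespace MuCal

/-- Basic formulas Φ_k over atomic propositions `At` and `k` registers. -/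
inductive Phi (At : Type) (k : ℕ) : Type
  | tt : Phi At k
  | ff : Phi At k
  | pos : At → Phi At k
  | npos : At → Phi At k
  | up : Fin k → Phi At k
  | nup : Fin k → Phi At k
  | conj : Phi At k → Phi At k → Phi At k

/-- LTL↓dω formulas over variables `Var`. -/
inductive Fml (At : Type) (k : ℕ) (Var : Type) : Type
  | var : Var → Fml At k Var
  | or : Fml At k Var → Fml At k Var → Fml At k Var
  | dX : Finset (Fin k) → Fml At k Var → Phi At k → Fml At k Var
  | tt : Fml At k Var

variable {At D Q Var : Type} {k : ℕ}

/-- θ[R←d] : update the registers in `R` to hold `d`. -/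
def updA (θ : Fin k → D) (R : Finset (Fin k)) (d : D) : Fin k → D :=
  fun r => if r ∈ R then d else θ r

/-- Satisfaction of basic formulas: w,i,θ ⊨ φ. -/
def phiSat (w : ℕ → Set At × D) (i : ℕ) (θ : Fin k → D) : Phi At k → Prop
  | Phi.tt => True
  | Phi.ff => False
  | Phi.pos p => p ∈ (w i).1
  | Phi.npos p => p ∉ (w i).1
  | Phi.up r => θ r = (w i).2
  | Phi.nup r => θ r ≠ (w i).2
  | Phi.conj φ₁ φ₂ => phiSat w i θ φ₁ ∧ phiSat w i θ φ₂

/-- Environments: each variable gets a set of 5-tuples (i,θ;j,θ′,x). -/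
abbrev Env (D : Type) (k : ℕ) (Var : Type) : Type :=
  Var → Set (ℕ × (Fin k → D) × ℕ × (Fin k → D) × Var)

/-- The augmented relation w,i,θ,j,θ′,x ⊨_u ψ. -/
def aSat (vtt : Var) (w : ℕ → Set At × D) (u : Env D k Var) :
    Fml At k Var → ℕ → (Fin k → D) → ℕ → (Fin k → D) → Var → Prop
  | Fml.var V, i, θ, j, θ', x => (i, θ, j, θ', x) ∈ u V
  | Fml.or ψ₁ ψ₂, i, θ, j, θ', x =>
      aSat vtt w u ψ₁ i θ j θ' x ∨ aSat vtt w u ψ₂ i θ j θ' x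
  | Fml.dX R ψ φ, i, θ, j, θ', x =>
      i < j ∧ phiSat w i θ φ ∧ aSat vtt w u ψ (i + 1) (updA θ R (w i).2) j θ' x
  | Fml.tt, _, θ, _, θ', x => θ = θ' ∧ x = vtt

/-- A system of equations: σ with a main variable, ω-variables, and V_tt. -/
structure EqSys (At : Type) (k : ℕ) (Var : Type) where
  σ : Var → Fml At k Var
  main : Var
  omega : Set Var
  vtt : Var

/-- Well-formedness conditions from Definition (system of equations):
V_tt ∈ Var_ω, σ(V_tt) = tt, and σ is injective on ω-variables. -/
def EqSys.WF (S : EqSys At k Var) : Prop :=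
  S.vtt ∈ S.omega ∧ S.σ S.vtt = Fml.tt ∧
    ∀ V ∈ S.omega, ∀ V' : Var, S.σ V = S.σ V' → V = V'

/-- The variable updating mapping F_{σ,w}. -/
def Fmap (S : EqSys At k Var) (w : ℕ → Set At × D) (u : Env D k Var) : Env D k Var :=
  fun V =>
    {t | aSat S.vtt w u (S.σ V) t.1 t.2.1 t.2.2.1 t.2.2.2.1 t.2.2.2.2} ∪
    {t | V ∈ S.omega ∧ ∃ (i : ℕ) (θ : Fin k → D), t = (i, θ, i, θ, V)}

/-- The least fixed point of F_{σ,w} (Knaster–Tarski form). -/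
def lfpEnv (S : EqSys At k Var) (w : ℕ → Set At × D) : Env D k Var :=
  sInf {u | Fmap S w u ≤ u}

/-- w,i,θ ⊨_u V : an infinite chain of dependence through u exists. -/
def satVar (S : EqSys At k Var) (w : ℕ → Set At × D) (u : Env D k Var)
    (i : ℕ) (θ : Fin k → D) (V : Var) : Prop :=
  ∃ (I : ℕ → ℕ) (Θ : ℕ → Fin k → D) (X : ℕ → Var),
    I 0 = i ∧ Θ 0 = θ ∧ X 0 = V ∧
    (∀ n, I n < I (n + 1)) ∧ (∀ n, X (n + 1) ∈ S.omega) ∧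
    (∀ n, (I n, Θ n, I (n + 1), Θ (n + 1), X (n + 1)) ∈ u (X n))

/-- w ⊨ σ : w,1,⊥^k ⊨_{lfp(F_{σ,w})} V_main. -/
def sats (S : EqSys At k Var) (dbot : D) (w : ℕ → Set At × D) : Prop :=
  satVar S w (lfpEnv S w) 1 (fun _ => dbot) S.main

/-- Normal form: every equation is V = V′ ∨ V″, V = ↓_R X V′ ∧ φ, or V = tt. -/
def InNormalForm (S : EqSys At k Var) : Prop :=
  ∀ V : Var,
    (∃ V₁ V₂ : Var, S.σ V = Fml.or (Fml.var V₁) (Fml.var V₂)) ∨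
    (∃ (R : Finset (Fin k)) (V₁ : Var) (φ : Phi At k), S.σ V = Fml.dX R (Fml.var V₁) φ) ∨
    S.σ V = Fml.tt

/-- `IsDisj ψ s` : ψ is an iterated disjunction of exactly the variables in `s`. -/
inductive IsDisj {At : Type} {k : ℕ} {Var : Type} : Fml At k Var → Set Var → Prop
  | var (V : Var) : IsDisj (Fml.var V) {V}
  | or {ψ₁ ψ₂ : Fml At k Var} {s₁ s₂ : Set Var} :
      IsDisj ψ₁ s₁ → IsDisj ψ₂ s₂ → IsDisj (Fml.or ψ₁ ψ₂) (s₁ ∪ s₂)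

/-- A Büchi register automaton with k registers; `none` as guard means ε. -/
structure BRA (At : Type) (k : ℕ) (Q : Type) where
  q0 : Q
  δ : Set (Q × Option (Phi At k) × Finset (Fin k) × Q)
  acc : Set Q

/-- One transition step on IDs (q,θ,i), where i is the current position. -/
inductive BStep (A : BRA At k Q) (w : ℕ → Set At × D) :
    Q × (Fin k → D) × ℕ → Q × (Fin k → D) × ℕ → Prop
  | rule {q q' : Q} {φ : Phi At k} {R : Finset (Fin k)} {θ : Fin k → D} {i : ℕ} :
      (q, some φ, R, q') ∈ A.δ → phiSat w i θ φ →
      BStep A w (q, θ, i) (q', updA θ R (w i).2, i + 1)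
  | eps {q q' : Q} {θ : Fin k → D} {i : ℕ} :
      (q, none, (∅ : Finset (Fin k)), q') ∈ A.δ →
      BStep A w (q, θ, i) (q', θ, i)

/-- ⊢* : reflexive-transitive closure of the step relation. -/
def BSteps (A : BRA At k Q) (w : ℕ → Set At × D) :
    Q × (Fin k → D) × ℕ → Q × (Fin k → D) × ℕ → Prop :=
  Relation.ReflTransGen (BStep A w)

/-- Büchi acceptance: some accepting state is visited at infinitely many,
strictly increasing positions, starting from (q₀, ⊥^k) at position 1. -/
def accepts (A : BRA At k Q) (dbot : D) (w : ℕ → Set At × D) : Prop :=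
  ∃ qF ∈ A.acc, ∃ (I : ℕ → ℕ) (Θ : ℕ → Fin k → D),
    1 ≤ I 0 ∧ (∀ n, I n < I (n + 1)) ∧
    BSteps A w (A.q0, fun _ => dbot, 1) (qF, Θ 0, I 0) ∧
    ∀ n, BSteps A w (qF, Θ n, I n) (qF, Θ (n + 1), I (n + 1))

def lang (A : BRA At k Q) (dbot : D) : Set (ℕ → Set At × D) :=
  {w | accepts A dbot w}

/-- The BRA constructed from a normal-form system σ (Theorem μ↓dω → BRA):
states are the formulas σ(V), initial state σ(V_t), accepting states σ(V_ω). -/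
def toBRA (S : EqSys At k Var) : BRA At k (Fml At k Var) where
  q0 := S.σ S.main
  δ :=
    {t | t = (Fml.tt, some Phi.tt, (∅ : Finset (Fin k)), Fml.tt)} ∪
    {t | ∃ V V₁ V₂ : Var, S.σ V = Fml.or (Fml.var V₁) (Fml.var V₂) ∧
          (t = (S.σ V, none, (∅ : Finset (Fin k)), S.σ V₁) ∨
           t = (S.σ V, none, (∅ : Finset (Fin k)), S.σ V₂))} ∪
    {t | ∃ (V : Var) (R : Finset (Fin k)) (V₁ : Var) (φ : Phi At k),
          S.σ V = Fml.dX R (Fml.var V₁) φ ∧ t = (S.σ V, some φ, R, S.σ V₁)}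
  acc := S.σ '' S.omega

/-- Variables of the system constructed from a BRA:
V_q for q ∈ Q, V_r for r ∈ δ, and V_tt. -/
abbrev RVar (A : BRA At k Q) : Type := Q ⊕ ({r // r ∈ A.δ} ⊕ Unit)

/-- The BRA 𝒜′ obtained by applying the μ↓dω-to-BRA construction (with m-ary
disjunction states) to the system σ constructed from 𝒜. -/
def roundBRA (A : BRA At k Q) (S : EqSys At k (RVar A)) :
    BRA At k (Fml At k (RVar A)) where
  q0 := S.σ (Sum.inl A.q0)
  δ :=
    {t | t = (Fml.tt, some Phi.tt, (∅ : Finset (Fin k)), Fml.tt)} ∪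
    {t | ∃ (q : Q) (r : {r // r ∈ A.δ}), r.val.1 = q ∧
          t = (S.σ (Sum.inl q), none, (∅ : Finset (Fin k)), S.σ (Sum.inr (Sum.inl r)))} ∪
    {t | ∃ r : {r // r ∈ A.δ},
          t = (S.σ (Sum.inr (Sum.inl r)), r.val.2.1, r.val.2.2.1,
               S.σ (Sum.inl r.val.2.2.2))}
  acc := (fun q : Q => S.σ (Sum.inl q)) '' A.acc ∪ {Fml.tt}

end MuCal

open MuCal

namespace MuCal

theorem aSat_mono {At D Var : Type} {k : ℕ} (vtt : Var) (w : ℕ → Set At × D)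
    {u v : Env D k Var} (huv : u ≤ v) (ψ : Fml At k Var) :
    ∀ {i : ℕ} {θ : Fin k → D} {j : ℕ} {θ' : Fin k → D} {x : Var},
      aSat vtt w u ψ i θ j θ' x → aSat vtt w v ψ i θ j θ' x := by
  induction ψ with
  | var V => exact fun h => huv V h
  | or ψ₁ ψ₂ ih₁ ih₂ => exact fun h => h.imp ih₁ ih₂
  | dX R ψ φ ih => exact fun h => ⟨h.1, h.2.1, ih h.2.2⟩
  | tt => exact id

theorem Fmap_mono {At D Var : Type} {k : ℕ} (S : EqSys At k Var) (w : ℕ → Set At × D) :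
    Monotone (Fmap S w) :=
  fun _ _ huv _ => Set.union_subset_union_left _ fun _ h => aSat_mono _ w huv _ h

theorem Fmap_lfpEnv {At D Var : Type} {k : ℕ} (S : EqSys At k Var) (w : ℕ → Set At × D) :
    Fmap S w (lfpEnv S w) = lfpEnv S w :=
  OrderHom.map_lfp ⟨Fmap S w, Fmap_mono S w⟩

theorem mem_lfpEnv {At D Var : Type} {k : ℕ} {S : EqSys At k Var} {w : ℕ → Set At × D}
    {i : ℕ} {θ : Fin k → D} {j : ℕ} {θ' : Fin k → D} {x V : Var} :
    (i, θ, j, θ', x) ∈ lfpEnv S w V ↔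
      aSat S.vtt w (lfpEnv S w) (S.σ V) i θ j θ' x ∨
        V ∈ S.omega ∧ i = j ∧ θ = θ' ∧ x = V := by
  conv_lhs => rw [← Fmap_lfpEnv]
  refine or_congr Iff.rfl (and_congr_right fun _ => ⟨?_, ?_⟩)
  · rintro ⟨i', θ₀, h⟩
    simp only [Prod.mk.injEq] at h
    obtain ⟨rfl, rfl, rfl, rfl, rfl⟩ := h
    exact ⟨rfl, rfl, rfl⟩
  · rintro ⟨rfl, rfl, rfl⟩
    exact ⟨i, θ, rfl⟩

theorem updA_empty {D : Type} {k : ℕ} (θ : Fin k → D) (d : D) : updA θ ∅ d = θ := by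
  funext r
  simp [updA]

theorem BSteps.pos_le {At D Q : Type} {k : ℕ} {A : BRA At k Q} {w : ℕ → Set At × D}
    {a b : Q × (Fin k → D) × ℕ} (h : BSteps A w a b) : a.2.2 ≤ b.2.2 := by
  induction h with
  | refl => exact le_rfl
  | tail _ hs ih => cases hs <;> grind

theorem BSteps.tt_loop {At D Var : Type} {k : ℕ} (S : EqSys At k Var) (w : ℕ → Set At × D)
    (θ : Fin k → D) {i j : ℕ} (hij : i ≤ j) :
    BSteps (toBRA S) w (Fml.tt, θ, i) (Fml.tt, θ, j) := by
  induction j, hij using Nat.le_induction with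
  | base => exact Relation.ReflTransGen.refl
  | succ j _ ih =>
    have hs : BStep (toBRA S) w (Fml.tt, θ, j) (Fml.tt, updA θ ∅ (w j).2, j + 1) :=
      .rule (φ := Phi.tt) (.inl (.inl rfl)) trivial
    rw [updA_empty] at hs
    exact ih.tail hs

/-- Every tuple of the least fixed point with `i ≤ j` is realised by a run. -/
theorem bSteps_of_mem_lfpEnv {At D Var : Type} {k : ℕ} {S : EqSys At k Var}
    (hvtt : S.σ S.vtt = Fml.tt) (hNF : InNormalForm S) {w : ℕ → Set At × D}
    {i : ℕ} {θ : Fin k → D} {j : ℕ} {θ' : Fin k → D} {x V : Var} (hij : i ≤ j)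
    (h : (i, θ, j, θ', x) ∈ lfpEnv S w V) :
    BSteps (toBRA S) w (S.σ V, θ, i) (S.σ x, θ', j) := by
  let u : Env D k Var := fun V => {t | t.1 ≤ t.2.2.1 →
    BSteps (toBRA S) w (S.σ V, t.2.1, t.1) (S.σ t.2.2.2.2, t.2.2.2.1, t.2.2.1)}
  have hu : Fmap S w u ≤ u := by
    rintro V ⟨i, θ, j, θ', x⟩ (h | ⟨_, i', θ₀, h⟩) hij
    · change aSat S.vtt w u (S.σ V) i θ j θ' x at h
      change BSteps (toBRA S) w (S.σ V, θ, i) (S.σ x, θ', j)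
      rcases hNF V with ⟨V₁, V₂, hV⟩ | ⟨R, V₁, φ, hV⟩ | hV
      · rw [hV] at h
        rcases h with h | h
        · exact .head (.eps (.inl (.inr ⟨V, V₁, V₂, hV, .inl rfl⟩))) (h hij)
        · exact .head (.eps (.inl (.inr ⟨V, V₁, V₂, hV, .inr rfl⟩))) (h hij)
      · rw [hV] at h
        exact .head (.rule (.inr ⟨V, R, V₁, φ, hV, rfl⟩) h.2.1) (h.2.2 h.1)
      · rw [hV] at h ⊢
        obtain ⟨rfl, rfl⟩ := h
        rw [hvtt]
        exact .tt_loop S w θ hij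
    · cases h
      exact .refl
  exact (sInf_le hu : lfpEnv S w ≤ u) V h hij

/-- Every run ending in the state of an ω-variable yields a tuple of the least fixed point. -/
theorem mem_lfpEnv_of_bSteps {At D Var : Type} {k : ℕ} {S : EqSys At k Var} (hWF : S.WF)
    {w : ℕ → Set At × D} {x : Var} (hx : x ∈ S.omega) {j : ℕ} {θ' : Fin k → D}
    {a : Fml At k Var × (Fin k → D) × ℕ} (h : BSteps (toBRA S) w a (S.σ x, θ', j)) :
    ∀ V : Var, S.σ V = a.1 → (a.2.2, a.2.1, j, θ', x) ∈ lfpEnv S w V := by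
  obtain ⟨hω, hvtt, hinj⟩ := hWF
  induction h using Relation.ReflTransGen.head_induction_on with
  | refl =>
    intro V hV
    obtain rfl := hinj x hx V hV.symm
    exact mem_lfpEnv.2 (.inr ⟨hx, rfl, rfl, rfl⟩)
  | head hs hrun ih =>
    intro V hV
    have hle := BSteps.pos_le hrun
    rw [mem_lfpEnv, hV]
    cases hs with
    | rule hδ hφ =>
      rcases hδ with (h | ⟨_, _, _, _, h | h⟩) | ⟨V', R, V₁, φ, hV', h⟩
      · cases h
        have := ih S.vtt hvtt
        rw [mem_lfpEnv, hvtt, updA_empty] at this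
        exact .inl (this.elim id fun h => h.2.2)
      · cases h
      · cases h
      · cases h
        dsimp only
        rw [hV']
        exact .inl ⟨hle, hφ, ih V₁ rfl⟩
    | eps hδ =>
      rcases hδ with (h | ⟨V', V₁, V₂, hV', h | h⟩) | ⟨_, _, _, _, _, h⟩
      · cases h
      · cases h
        dsimp only
        rw [hV']
        exact .inl (.inl (ih V₁ rfl))
      · cases h
        dsimp only
        rw [hV']
        exact .inl (.inr (ih V₂ rfl))
      · cases h

end MuCal

/-- Finite-run correspondence lemma:
w,i,θ,j,θ′,x ⊨_{lfp(F_{σ,w})} V iff (σ(V),θ,w[i..]) ⊢* (σ(x),θ′,w[j..]) and σ(x) ∈ F. -/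
theorem finite_run_correspondence (At D : Type) [Finite At] [Countable D] [Infinite D]
    (k : ℕ) (Var : Type) [Finite Var]
    (S : EqSys At k Var) (hWF : S.WF) (hNF : InNormalForm S)
    (w : ℕ → Set At × D) (i j : ℕ) (hij : i ≤ j) (θ θ' : Fin k → D)
    (V : Var) (x : Var) (hx : x ∈ S.omega) :
    (i, θ, j, θ', x) ∈ lfpEnv S w V ↔
      (BSteps (toBRA S) w (S.σ V, θ, i) (S.σ x, θ', j) ∧ S.σ x ∈ (toBRA S).acc) := by
  exact ⟨fun h => ⟨bSteps_of_mem_lfpEnv hWF.2.1 hNF hij h, x, hx, rfl⟩,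
    fun h => mem_lfpEnv_of_bSteps hWF hx h.1 V rfl⟩
end

section
/- (Language equality in the round-trip construction) Let 𝒜 = (Q, q₀, δ, F) be a k-BRA without ε-rules in which every state has at least one outgoing transition, σ the system of equations constructed from 𝒜, and 𝒜′ the BRA obtained by applying the μ↓dω-to-BRA construction (with m-ary disjunctions) to σ. Then L(𝒜) = L(𝒜′); in particular, since the state tt of 𝒜′ is not reachable from its initial state, every accepting computation of 𝒜′ visits a state σ(V_q) with q ∈ F infinitely often, and the run correspondence (q,θ,w[i..]) ⊢*_𝒜 (q′,θ′,w[j..]) ⟺ (σ(V_q),θ,w[i..]) ⊢*_{𝒜′} (σ(V_{q′}),θ′,w[j..]) suffices to establish the equality. -/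
namespace MuCal

variable {At D Q Var : Type} {k : ℕ}

/-- The variables occurring in a formula. -/
def Fml.vars : Fml At k Var → Set Var
  | Fml.var V => {V}
  | Fml.or ψ₁ ψ₂ => ψ₁.vars ∪ ψ₂.vars
  | Fml.dX _ ψ _ => ψ.vars
  | Fml.tt => ∅

theorem IsDisj.vars_eq {ψ : Fml At k Var} {s : Set Var} (h : IsDisj ψ s) : ψ.vars = s := by
  induction h with
  | var V => rfl
  | or _ _ ih₁ ih₂ => simp only [Fml.vars, ih₁, ih₂]

theorem IsDisj.ne_dX {ψ : Fml At k Var} {s : Set Var} (h : IsDisj ψ s) (R : Finset (Fin k))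
    (χ : Fml At k Var) (φ : Phi At k) : ψ ≠ Fml.dX R χ φ := by
  cases h <;> simp

theorem IsDisj.ne_tt {ψ : Fml At k Var} {s : Set Var} (h : IsDisj ψ s) : ψ ≠ Fml.tt := by
  cases h <;> simp

/-- The hypotheses on `S` that make it the system of equations constructed from the
ε-free automaton `A` in which every state has an outgoing rule. -/
structure IsSystemOf (A : BRA At k Q) (S : EqSys At k (RVar A)) : Prop where
  noEps : ∀ (q : Q) (R : Finset (Fin k)) (q' : Q), (q, none, R, q') ∉ A.δ
  out : ∀ q : Q, ∃ (φ : Phi At k) (R : Finset (Fin k)) (q' : Q), (q, some φ, R, q') ∈ A.δ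
  state : ∀ q : Q, IsDisj (S.σ (Sum.inl q))
    {V : RVar A | ∃ r : {r // r ∈ A.δ}, r.val.1 = q ∧ V = Sum.inr (Sum.inl r)}
  rule : ∀ (r : {r // r ∈ A.δ}) (q : Q) (φ : Phi At k) (R : Finset (Fin k)) (q' : Q),
    r.val = (q, some φ, R, q') →
    S.σ (Sum.inr (Sum.inl r)) = Fml.dX R (Fml.var (Sum.inl q')) φ

namespace IsSystemOf

variable {A : BRA At k Q} {S : EqSys At k (RVar A)}

theorem state_injective (h : IsSystemOf A S) :
    Function.Injective fun q : Q => S.σ (Sum.inl q) := by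
  intro p q hpq
  have hs := (h.state p).vars_eq.symm.trans ((congrArg Fml.vars hpq).trans (h.state q).vars_eq)
  obtain ⟨φ, R, q', hp⟩ := h.out p
  have hm : (Sum.inr (Sum.inl ⟨_, hp⟩) : RVar A) ∈
      {V : RVar A | ∃ r : {r // r ∈ A.δ}, r.val.1 = p ∧ V = Sum.inr (Sum.inl r)} :=
    ⟨⟨_, hp⟩, rfl, rfl⟩
  rw [hs] at hm
  obtain ⟨r, hrq, hr⟩ := hm
  simp only [Sum.inr.injEq, Sum.inl.injEq] at hr
  subst hr
  exact hrq

theorem exists_rule (h : IsSystemOf A S) (r : {r // r ∈ A.δ}) :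
    ∃ q φ R q', r.val = (q, some φ, R, q') ∧
      S.σ (Sum.inr (Sum.inl r)) = Fml.dX R (Fml.var (Sum.inl q')) φ := by
  obtain ⟨⟨q, _ | φ, R, q'⟩, hr⟩ := r
  · exact absurd hr (h.noEps q R q')
  · exact ⟨q, φ, R, q', rfl, h.rule _ q φ R q' rfl⟩

theorem bsteps_roundBRA (h : IsSystemOf A S) {w : ℕ → Set At × D} {q q' : Q}
    {θ θ' : Fin k → D} {i j : ℕ} (hs : BSteps A w (q, θ, i) (q', θ', j)) :
    BSteps (roundBRA A S) w (S.σ (Sum.inl q), θ, i) (S.σ (Sum.inl q'), θ', j) := by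
  refine Relation.ReflTransGen.lift' (fun c : Q × (Fin k → D) × ℕ => (S.σ (Sum.inl c.1), c.2))
    (fun a b hab => ?_) _ _ hs
  cases hab with
  | @rule q q' φ R θ i hδ hφ =>
    refine (Relation.ReflTransGen.single
      (BStep.eps (q' := S.σ (Sum.inr (Sum.inl ⟨_, hδ⟩))) ?_)).tail
      (BStep.rule ?_ hφ)
    · exact Or.inl (Or.inr ⟨q, ⟨_, hδ⟩, rfl, rfl⟩)
    · exact Or.inr ⟨⟨_, hδ⟩, rfl⟩
  | eps hδ => exact absurd hδ (h.noEps _ _ _)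

/-- The configurations of `roundBRA A S` that simulate a configuration `c` of `A`: the state
is that of `c`, or the formula of a rule leaving it. -/
def Simulates (S : EqSys At k (RVar A)) (c : Q × (Fin k → D) × ℕ)
    (c' : Fml At k (RVar A) × (Fin k → D) × ℕ) : Prop :=
  c'.2 = c.2 ∧ (c'.1 = S.σ (Sum.inl c.1) ∨
    ∃ r : {r // r ∈ A.δ}, r.val.1 = c.1 ∧ c'.1 = S.σ (Sum.inr (Sum.inl r)))

theorem exists_bsteps_of_bstep (h : IsSystemOf A S) {w : ℕ → Set At × D}
    {c : Q × (Fin k → D) × ℕ} {c' d' : Fml At k (RVar A) × (Fin k → D) × ℕ}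
    (hc : Simulates S c c') (hs : BStep (roundBRA A S) w c' d') :
    ∃ d, BSteps A w c d ∧ Simulates S d d' := by
  obtain ⟨p, η⟩ := c
  obtain ⟨hη, hc⟩ := hc
  cases hs with
  | @rule ψ ψ' φ R θ i hδ hφ =>
    dsimp only at hη hc
    subst hη
    rcases hδ with (hδ | ⟨q, r, hrq, hδ⟩) | ⟨r, hδ⟩
    · simp only [Set.mem_ofPred_eq, Prod.mk.injEq] at hδ
      rw [hδ.1] at hc
      rcases hc with hc | ⟨r, -, hc⟩
      · exact absurd hc.symm (h.state p).ne_tt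
      · obtain ⟨_, _, _, _, -, hr⟩ := h.exists_rule r
        simp [hr] at hc
    · simp at hδ
    · simp only [Prod.mk.injEq] at hδ
      obtain ⟨h1, h2, h3, h4⟩ := hδ
      obtain ⟨q₁, φ₁, R₁, q₁', hr₁, hσ₁⟩ := h.exists_rule r
      rw [hr₁] at h2 h3 h4
      simp only [Option.some.injEq] at h2
      subst h2 h3 h4
      rw [h1, hσ₁] at hc
      rcases hc with hc | ⟨r₂, hp, hc⟩
      · exact absurd hc.symm ((h.state p).ne_dX _ _ _)
      · obtain ⟨q₂, φ₂, R₂, q₂', hr₂, hσ₂⟩ := h.exists_rule r₂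
        rw [hσ₂] at hc
        simp only [Fml.dX.injEq, Fml.var.injEq, Sum.inl.injEq] at hc
        obtain ⟨rfl, rfl, rfl⟩ := hc
        have hm := r₂.property
        rw [hr₂] at hp hm
        dsimp only at hp
        subst hp
        exact ⟨_, Relation.ReflTransGen.single (BStep.rule hm hφ), rfl, Or.inl rfl⟩
  | @eps ψ ψ' θ i hδ =>
    dsimp only at hη hc
    subst hη
    rcases hδ with (hδ | ⟨q, r, hrq, hδ⟩) | ⟨r, hδ⟩
    · simp at hδ
    · simp only [Prod.mk.injEq, true_and] at hδ
      obtain ⟨h1, h2⟩ := hδ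
      rw [h1] at hc
      rcases hc with hc | ⟨r₂, -, hc⟩
      · have hqp : q = p := h.state_injective hc
        exact ⟨_, Relation.ReflTransGen.refl, rfl, Or.inr ⟨r, hrq.trans hqp, h2⟩⟩
      · obtain ⟨_, _, _, _, -, hσ⟩ := h.exists_rule r₂
        exact absurd (hc.trans hσ) ((h.state q).ne_dX _ _ _)
    · obtain ⟨_, _, _, _, hr, -⟩ := h.exists_rule r
      simp [hr] at hδ

theorem exists_bsteps (h : IsSystemOf A S) {w : ℕ → Set At × D} {q : Q}
    {θ : Fin k → D} {i : ℕ} {c' : Fml At k (RVar A) × (Fin k → D) × ℕ}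
    (hs : BSteps (roundBRA A S) w (S.σ (Sum.inl q), θ, i) c') :
    ∃ c, BSteps A w (q, θ, i) c ∧ Simulates S c c' := by
  induction hs with
  | refl => exact ⟨_, Relation.ReflTransGen.refl, rfl, Or.inl rfl⟩
  | tail _ hstep ih =>
    obtain ⟨c, hc, hsim⟩ := ih
    obtain ⟨d, hd, hsim'⟩ := h.exists_bsteps_of_bstep hsim hstep
    exact ⟨d, hc.trans hd, hsim'⟩

/-- The run correspondence between `A` and `roundBRA A S`. -/
theorem bsteps_iff (h : IsSystemOf A S) {w : ℕ → Set At × D} {q q' : Q}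
    {θ θ' : Fin k → D} {i j : ℕ} :
    BSteps A w (q, θ, i) (q', θ', j) ↔
      BSteps (roundBRA A S) w (S.σ (Sum.inl q), θ, i) (S.σ (Sum.inl q'), θ', j) := by
  refine ⟨h.bsteps_roundBRA, fun hs => ?_⟩
  obtain ⟨⟨p, η⟩, hc, hη, hp | ⟨r, -, hp⟩⟩ := h.exists_bsteps hs
  · have hqp : q' = p := h.state_injective hp
    dsimp only at hη
    rwa [hqp, hη]
  · obtain ⟨_, _, _, _, -, hr⟩ := h.exists_rule r
    exact absurd (hp.trans hr) ((h.state q').ne_dX _ _ _)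

/-- The state `tt` is not reachable from a state `σ(V_q)`. -/
theorem not_bsteps_tt (h : IsSystemOf A S) {w : ℕ → Set At × D} {q : Q}
    {θ θ' : Fin k → D} {i j : ℕ} :
    ¬ BSteps (roundBRA A S) w (S.σ (Sum.inl q), θ, i) (Fml.tt, θ', j) := by
  intro hs
  obtain ⟨⟨p, η⟩, -, -, hp | ⟨r, -, hp⟩⟩ := h.exists_bsteps hs
  · exact (h.state p).ne_tt hp.symm
  · obtain ⟨_, _, _, _, -, hr⟩ := h.exists_rule r
    exact Fml.noConfusion rfl rfl rfl (heq_of_eq (hp.trans hr))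

theorem lang_eq (h : IsSystemOf A S) (dbot : D) : lang A dbot = lang (roundBRA A S) dbot := by
  ext w
  constructor
  · rintro ⟨qF, hF, I, Θ, hI, hlt, h0, hn⟩
    exact ⟨_, Or.inl ⟨qF, hF, rfl⟩, I, Θ, hI, hlt, h.bsteps_iff.1 h0,
      fun n => h.bsteps_iff.1 (hn n)⟩
  · rintro ⟨_, ⟨qF, hF, rfl⟩ | rfl, I, Θ, hI, hlt, h0, hn⟩
    · exact ⟨qF, hF, I, Θ, hI, hlt, h.bsteps_iff.2 h0, fun n => h.bsteps_iff.2 (hn n)⟩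
    · exact absurd h0 h.not_bsteps_tt

end IsSystemOf

end MuCal

open MuCal
/-- Language equality in the round-trip construction: L(𝒜) = L(𝒜′). -/
theorem round_trip_lang_eq (At D Q : Type) [Finite At] [Countable D] [Infinite D] (dbot : D)
    (k : ℕ) [Finite Q] (A : BRA At k Q)
    (hNoEps : ∀ (q : Q) (R : Finset (Fin k)) (q' : Q), (q, none, R, q') ∉ A.δ)
    (hOut : ∀ q : Q, ∃ (φ : Phi At k) (R : Finset (Fin k)) (q' : Q), (q, some φ, R, q') ∈ A.δ)
    (S : EqSys At k (RVar A))
    (hmain : S.main = Sum.inl A.q0)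
    (hvtt : S.vtt = Sum.inr (Sum.inr ()))
    (homega : S.omega = Sum.inl '' A.acc ∪ {Sum.inr (Sum.inr ())})
    (hq : ∀ q : Q, IsDisj (S.σ (Sum.inl q))
        {V : RVar A | ∃ r : {r // r ∈ A.δ}, r.val.1 = q ∧ V = Sum.inr (Sum.inl r)})
    (hr : ∀ (r : {r // r ∈ A.δ}) (q : Q) (φ : Phi At k) (R : Finset (Fin k)) (q' : Q),
        r.val = (q, some φ, R, q') →
        S.σ (Sum.inr (Sum.inl r)) = Fml.dX R (Fml.var (Sum.inl q')) φ)
    (htt : S.σ (Sum.inr (Sum.inr ())) = Fml.tt) :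
    lang A dbot = lang (roundBRA A S) dbot := by
  exact IsSystemOf.lang_eq ⟨hNoEps, hOut, hq, hr⟩ dbot
end
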